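/- arXiv:2406.12351 — 9 statements merged into one kernel-verified Lean document; each statement's English description precedes it below -/
import Mathlib

section
/- Let R be a commutative ring in which 2 is invertible, let n ≥ 1, and let Δ be an invertible n×n matrix over R. Form the 2n×2n block matrices C = [[(2Δ)⁻¹, −(2Δ)⁻¹],[1ₙ, 1ₙ]] (which is invertible, with inverse [[Δ, 2⁻¹·1ₙ],[−Δ, 2⁻¹·1ₙ]]), J = [[1ₙ, 0],[0, −1ₙ]], and for n×n matrices g₁, g₂ over R set ι(g₁,g₂) = C·[[g₁,0],[0,g₂]]·C⁻¹. Then J·ι(g₁,g₂)·J = ι(g₂,g₁) for all g₁, g₂ ∈ Mₙ(R). -/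
open Matrix

/-- Let `R` be a commutative ring in which 2 is invertible, `n ≥ 1`,
and `Δ` an invertible `n × n` matrix over `R`.  With
`C = [[(2Δ)⁻¹, −(2Δ)⁻¹],[1ₙ, 1ₙ]]` (whose inverse is `[[Δ, 2⁻¹·1ₙ],[−Δ, 2⁻¹·1ₙ]]`),
`J = [[1ₙ,0],[0,−1ₙ]]` and `ι(g₁,g₂) = C·[[g₁,0],[0,g₂]]·C⁻¹`, one has
`J·ι(g₁,g₂)·J = ι(g₂,g₁)` for all `g₁, g₂ ∈ Mₙ(R)`. -/
theorem stmt0 {R : Type*} [CommRing R] (n : ℕ) (hn : 1 ≤ n)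
    [Invertible (2 : R)] (Δ : Matrix (Fin n) (Fin n) R) [Invertible Δ] :
    let C : Matrix (Fin n ⊕ Fin n) (Fin n ⊕ Fin n) R :=
      Matrix.fromBlocks ((2 : R) • Δ)⁻¹ (-(((2 : R) • Δ)⁻¹)) 1 1
    let J : Matrix (Fin n ⊕ Fin n) (Fin n ⊕ Fin n) R :=
      Matrix.fromBlocks 1 0 0 (-1)
    -- `C` is invertible, with the asserted explicit inverse
    (C * Matrix.fromBlocks Δ ((⅟(2 : R)) • (1 : Matrix (Fin n) (Fin n) R)) (-Δ)
        ((⅟(2 : R)) • (1 : Matrix (Fin n) (Fin n) R)) = 1 ∧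
      Matrix.fromBlocks Δ ((⅟(2 : R)) • (1 : Matrix (Fin n) (Fin n) R)) (-Δ)
        ((⅟(2 : R)) • (1 : Matrix (Fin n) (Fin n) R)) * C = 1) ∧
    -- the main identity `J·ι(g₁,g₂)·J = ι(g₂,g₁)`
    ∀ g₁ g₂ : Matrix (Fin n) (Fin n) R,
      J * (C * Matrix.fromBlocks g₁ 0 0 g₂ * C⁻¹) * J
        = C * Matrix.fromBlocks g₂ 0 0 g₁ * C⁻¹ := by
  intro C J
  set D : Matrix (Fin n ⊕ Fin n) (Fin n ⊕ Fin n) R :=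
    Matrix.fromBlocks Δ ((⅟(2 : R)) • (1 : Matrix (Fin n) (Fin n) R)) (-Δ)
      ((⅟(2 : R)) • (1 : Matrix (Fin n) (Fin n) R)) with hD
  have h_inv_mul : ((2 : R) • Δ)⁻¹ * Δ = (⅟(2 : R)) • (1 : Matrix (Fin n) (Fin n) R) := by
    have h : ((2 : R) • Δ)⁻¹ = (⅟(2 : R)) • ⅟Δ := by
      refine Matrix.inv_eq_left_inv ?_
      simp [smul_smul]
    simp [h]
  have h_half : (⅟(2 : R)) • (1 : Matrix (Fin n) (Fin n) R) +
      (⅟(2 : R)) • (1 : Matrix (Fin n) (Fin n) R) = 1 := by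
    rw [← add_smul, invOf_two_add_invOf_two, one_smul]
  have hCD : C * D = 1 := by
    simp only [C, hD, Matrix.fromBlocks_multiply, ← Matrix.fromBlocks_one, mul_neg,
      neg_neg, h_inv_mul, h_half, neg_mul, one_mul, add_neg_cancel]
  refine ⟨⟨hCD, mul_eq_one_comm.mp hCD⟩, fun g₁ g₂ => ?_⟩
  rw [Matrix.inv_eq_right_inv hCD]
  simp only [C, J, hD, Matrix.fromBlocks_multiply]
  congr 1 <;> simp [add_comm]
end

section
/- Let E be a field equipped with a ring automorphism c (written x ↦ x̄) with c∘c = id, in which 2 is invertible. Let δ ∈ E be nonzero with δ̄ = −δ, let a, y ∈ E be fixed by c with a ≠ 0, and set θ = 2aδ (so θ̄ = −θ and θ ≠ 0). Let C = [[(2δ)⁻¹, −(2δ)⁻¹],[1, 1]] (invertible, with inverse [[δ, 1/2],[−δ, 1/2]]) and ς = [[θ⁻¹, 0],[0, −θ]]. Assume 1 + yθ ≠ 0 (equivalently 1 + yθ̄ ≠ 0) and set β = (1+yθ)/(1+yθ̄). Then ς⁻¹·(C·[[β,0],[0,1]]·C⁻¹)·ς = [[1, a·y·θ·θ̄],[0,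 1]] · [[1+yθ, 0],[0, (1+yθ̄)⁻¹]] · [[1, 0],[−y/a, 1]]. -/
open Matrix

/-- Let `E` be a field with an involutive ring automorphism `c`,
`2 ≠ 0`, `δ ≠ 0` with `c δ = −δ`, `a, y` fixed by `c` with `a ≠ 0`, and `θ = 2aδ`
(so `c θ = −θ` and `θ ≠ 0`).  With `C = [[(2δ)⁻¹, −(2δ)⁻¹],[1,1]]` (invertible with
inverse `[[δ, 1/2],[−δ, 1/2]]`), `ς = [[θ⁻¹,0],[0,−θ]]`, if `1 + yθ ≠ 0`
(equivalently `1 + y·c θ ≠ 0`), and `β = (1+yθ)/(1+y·c θ)`, then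
`ς⁻¹·(C·diag(β,1)·C⁻¹)·ς = [[1, a y θ c(θ)],[0,1]]·[[1+yθ,0],[0,(1+y·c θ)⁻¹]]·[[1,0],[−y/a,1]]`. -/
theorem stmt2 {E : Type*} [Field E] (c : E ≃+* E) (hc : ∀ x, c (c x) = x)
    (h2 : (2 : E) ≠ 0) (δ : E) (hδ0 : δ ≠ 0) (hδ : c δ = -δ)
    (a y : E) (ha : c a = a) (hy : c y = y) (ha0 : a ≠ 0)
    (h1 : 1 + y * (2 * a * δ) ≠ 0) :
    let θ : E := 2 * a * δ
    let C : Matrix (Fin 2) (Fin 2) E := !![(2 * δ)⁻¹, -(2 * δ)⁻¹; 1, 1]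
    let ς : Matrix (Fin 2) (Fin 2) E := !![θ⁻¹, 0; 0, -θ]
    let β : E := (1 + y * θ) / (1 + y * c θ)
    -- `θ̄ = −θ` and `θ ≠ 0`; equivalently `1 + y θ̄ ≠ 0`
    (c θ = -θ ∧ θ ≠ 0) ∧ 1 + y * c θ ≠ 0 ∧
    -- `C` is invertible with inverse `[[δ, 1/2],[−δ, 1/2]]`
    (C * !![δ, 2⁻¹; -δ, 2⁻¹] = 1 ∧ !![δ, 2⁻¹; -δ, 2⁻¹] * C = 1) ∧
    -- the decomposition
    ς⁻¹ * (C * !![β, 0; 0, 1] * C⁻¹) * ς =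
      !![1, a * y * (θ * c θ); 0, 1] *
        !![1 + y * θ, 0; 0, (1 + y * c θ)⁻¹] *
        !![1, 0; -(y / a), 1] := by
  intro θ C ς β
  have hcθ : c θ = -θ := by
    simp only [θ, map_mul, map_ofNat, ha, hδ, mul_neg]
  have hθ : θ ≠ 0 := mul_ne_zero (mul_ne_zero h2 ha0) hδ0
  have hden : 1 + y * c θ ≠ 0 := by
    intro h
    apply h1
    simpa [hy, hc] using congrArg c h
  have hC : C * !![δ, 2⁻¹; -δ, 2⁻¹] = 1 := by
    ext i j
    fin_cases i <;> fin_cases j <;> simp [C] <;> field_simp <;> norm_num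
  have hC' : !![δ, 2⁻¹; -δ, 2⁻¹] * C = 1 := mul_eq_one_comm.mp hC
  have hς : ς⁻¹ = !![θ, 0; 0, -θ⁻¹] := by
    apply inv_eq_right_inv
    ext i j
    fin_cases i <;> fin_cases j <;> simp [ς, hθ]
  refine ⟨⟨hcθ, hθ⟩, hden, ⟨hC, hC'⟩, ?_⟩
  rw [inv_eq_right_inv hC, hς]
  rw [hcθ] at hden
  obtain ⟨d, hd⟩ : ∃ d, 1 + y * -θ = d := ⟨_, rfl⟩
  simp only [C, ς, β, hcθ, hd]
  rw [hd] at hden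
  ext i j
  fin_cases i <;> fin_cases j <;>
    simp [θ, mul_apply, Fin.sum_univ_two] <;> field_simp <;>
    simp only [← hd, θ] <;> ring
end

section
/- Let E be a field equipped with a ring automorphism c (written x ↦ x̄) with c∘c = id, in which 2 is invertible. Let δ ∈ E be nonzero with δ̄ = −δ, let a, y ∈ E be fixed by c with a ≠ 0, and set θ = 2aδ (so θ̄ = −θ and θ ≠ 0; in particular y + θ ≠ 0 and y + θ̄ ≠ 0). Let C = [[(2δ)⁻¹, −(2δ)⁻¹],[1, 1]] and ς = [[θ⁻¹, 0],[0, −θ]], and set β = (y+θ)/(y+θ̄). Then ς⁻¹·(C·[[β,0],[0,1]]·C⁻¹)·ς = [[1, −a·y],[0, 1]] · [[y+θ, 0],[0, (y+θ̄)⁻¹]] · [[0, a],[−a⁻¹, 0]] · [[1, −a·y],[0, 1]]. -/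
open Matrix

/-- Let `E` be a field with an involutive ring automorphism `c`,
`2 ≠ 0`, `δ ≠ 0` with `c δ = −δ`, `a, y` fixed by `c` with `a ≠ 0`, and `θ = 2aδ`
(so `c θ = −θ`, `θ ≠ 0`; in particular `y + θ ≠ 0` and `y + c θ ≠ 0`).  With
`C = [[(2δ)⁻¹, −(2δ)⁻¹],[1,1]]`, `ς = [[θ⁻¹,0],[0,−θ]]` and `β = (y+θ)/(y+c θ)`:
`ς⁻¹·(C·diag(β,1)·C⁻¹)·ς
  = [[1,−ay],[0,1]]·[[y+θ,0],[0,(y+c θ)⁻¹]]·[[0,a],[−a⁻¹,0]]·[[1,−ay],[0,1]]`. -/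
theorem stmt3 {E : Type*} [Field E] (c : E ≃+* E) (hc : ∀ x, c (c x) = x)
    (h2 : (2 : E) ≠ 0) (δ : E) (hδ0 : δ ≠ 0) (hδ : c δ = -δ)
    (a y : E) (ha : c a = a) (hy : c y = y) (ha0 : a ≠ 0) :
    let θ : E := 2 * a * δ
    let C : Matrix (Fin 2) (Fin 2) E := !![(2 * δ)⁻¹, -(2 * δ)⁻¹; 1, 1]
    let ς : Matrix (Fin 2) (Fin 2) E := !![θ⁻¹, 0; 0, -θ]
    let β : E := (y + θ) / (y + c θ)
    -- `θ̄ = −θ`, `θ ≠ 0`, and in particular `y + θ ≠ 0`, `y + θ̄ ≠ 0`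
    (c θ = -θ ∧ θ ≠ 0) ∧ (y + θ ≠ 0 ∧ y + c θ ≠ 0) ∧
    -- the decomposition
    ς⁻¹ * (C * !![β, 0; 0, 1] * C⁻¹) * ς =
      !![1, -(a * y); 0, 1] *
        !![y + θ, 0; 0, (y + c θ)⁻¹] *
        !![0, a; -a⁻¹, 0] *
        !![1, -(a * y); 0, 1] := by
  intro θ C ς β
  have hcθ : c θ = -θ := by simp [θ, ha, hδ, map_ofNat c 2]
  have hθ0 : θ ≠ 0 := mul_ne_zero (mul_ne_zero h2 ha0) hδ0
  have hadd : y + θ ≠ 0 := fun h ↦ by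
    have hconj : y + -θ = 0 := by simpa [hy, hcθ] using congrArg c h
    exact mul_ne_zero h2 hθ0 (by linear_combination h - hconj)
  have hsub : y - θ ≠ 0 := fun h ↦ by
    have hconj : y + θ = 0 := by simpa [hy, hcθ] using congrArg c h
    exact hadd hconj
  have hC : C⁻¹ = !![δ, 2⁻¹; -δ, 2⁻¹] := by
    refine Matrix.inv_eq_right_inv ?_
    ext i j
    fin_cases i <;> fin_cases j <;> simp [C, Matrix.mul_apply, Fin.sum_univ_two] <;>
      field_simp <;> ring
  have hς : ς⁻¹ = !![θ, 0; 0, -θ⁻¹] := by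
    refine Matrix.inv_eq_right_inv ?_
    ext i j
    fin_cases i <;> fin_cases j <;> simp [ς, Matrix.mul_apply, Fin.sum_univ_two, hθ0]
  have hδθ : δ = θ / (2 * a) := by simp only [θ]; field_simp
  refine ⟨⟨hcθ, hθ0⟩, ⟨hadd, by rwa [hcθ, ← sub_eq_add_neg]⟩, ?_⟩
  rw [hC, hς]
  simp only [C, ς, β, hcθ, ← sub_eq_add_neg]
  clear_value θ
  subst hδθ
  ext i j
  fin_cases i <;> fin_cases j <;> simp [Matrix.mul_apply, Fin.sum_univ_two] <;>
    field_simp <;> ring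
end

section
/- Let Z be a 2×2 complex matrix such that the Hermitian matrix i·(Zᴴ − Z) is positive definite (where Zᴴ is the conjugate transpose). Then Z is invertible, and for all k₁, k₂ ∈ ℕ and every row vector z ∈ ℂ²: 4·∫_{ℂ²} w₁^{k₁}·w₂^{k₂}·exp(2πi·Q_Z(w))·exp(−2πi·(⟨w,z⟩ + ⟨z,w⟩)) dV(w) = det(i·Z⁻¹)·u₁^{k₁}·u₂^{k₂}·exp(−2πi·Q_{Z⁻¹}(z)), where Q_M(w) = Σ_{j,l} wⱼ·M_{jl}·conj(w_l), ⟨w,z⟩ = Σⱼ wⱼ·conj(zⱼ), u = z·Z⁻¹ (row vector times matrix), and V is the Lebesgue measure on ℂ² (the product of planar Lebesgue measures). Note that positive definiteness of i(Zᴴ−Z) makes the Gaussian factor exp(2πi·Q_Z(w)) integrable. -/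
open MeasureTheory Matrix
open scoped ComplexOrder
open ComplexConjugate Polynomial

/-- A Gaussian with linear exponential growth, times a power of the norm, is integrable on `ℂ`. -/
lemma integrable_norm_pow_mul_exp {δ : ℝ} (hδ : 0 < δ) (C : ℝ) (k : ℕ) :
    Integrable fun w : ℂ ↦ ‖w‖ ^ k * Real.exp (C * ‖w‖ - δ * ‖w‖ ^ 2) := by
  have hg : Integrable fun w : ℂ ↦ Real.exp (-(δ / 2) * ‖w‖ ^ 2) := by
    have h := (GaussianFourier.integrable_cexp_neg_mul_sq_norm_add (b := ((δ / 2 : ℝ) : ℂ))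
      (by simpa using hδ) 0 (0 : ℂ)).norm
    refine h.congr (.of_forall fun w ↦ ?_)
    simp only [zero_mul, add_zero, Complex.norm_exp]
    norm_cast
  refine (hg.const_mul (k.factorial * Real.exp ((C + 1) ^ 2 / (2 * δ)))).mono'
    (by fun_prop) (.of_forall fun w ↦ ?_)
  have hpow : ‖w‖ ^ k ≤ k.factorial * Real.exp ‖w‖ := by
    have := Real.pow_div_factorial_le_exp ‖w‖ (norm_nonneg w) k
    rwa [div_le_iff₀ (by positivity), mul_comm] at this
  rw [Real.norm_of_nonneg (by positivity)]
  calc ‖w‖ ^ k * Real.exp (C * ‖w‖ - δ * ‖w‖ ^ 2)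
      ≤ k.factorial * Real.exp ‖w‖ * Real.exp (C * ‖w‖ - δ * ‖w‖ ^ 2) := by gcongr
    _ = k.factorial * Real.exp (‖w‖ + (C * ‖w‖ - δ * ‖w‖ ^ 2)) := by
        rw [mul_assoc, ← Real.exp_add]
    _ ≤ k.factorial * Real.exp ((C + 1) ^ 2 / (2 * δ) + -(δ / 2) * ‖w‖ ^ 2) := by
        refine mul_le_mul_of_nonneg_left (Real.exp_le_exp.2 ?_) (by positivity)
        have : (C + 1) ^ 2 / (2 * δ) + -(δ / 2) * ‖w‖ ^ 2 - (‖w‖ + (C * ‖w‖ - δ * ‖w‖ ^ 2))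
            = ((C + 1) - δ * ‖w‖) ^ 2 / (2 * δ) := by field
        have : 0 ≤ ((C + 1) - δ * ‖w‖) ^ 2 / (2 * δ) := by positivity
        linarith
    _ = _ := by rw [Real.exp_add, mul_assoc]

lemma re_mul_add_mul_conj_le (b c w : ℂ) :
    (b * w + c * conj w).re ≤ (‖b‖ + ‖c‖) * ‖w‖ :=
  calc (b * w + c * conj w).re ≤ ‖b * w + c * conj w‖ := Complex.re_le_norm _
    _ ≤ ‖b * w‖ + ‖c * conj w‖ := norm_add_le _ _
    _ = _ := by rw [norm_mul, norm_mul, Complex.norm_conj]; ring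

lemma integrable_eval_mul_cexp_neg_mul_conj {a : ℂ} (ha : 0 < a.re) (b c : ℂ) (p : ℂ[X]) :
    Integrable fun w : ℂ ↦ p.eval w * Complex.exp (-a * (w * conj w) + b * w + c * conj w) := by
  induction p using Polynomial.induction_on' with
  | add p q hp hq => simpa only [eval_add, add_mul] using! hp.add hq
  | monomial n r =>
    simp only [eval_monomial, mul_assoc r]
    refine ((integrable_norm_pow_mul_exp ha (‖b‖ + ‖c‖) n).mono' ?_
      (.of_forall fun w ↦ ?_)).const_mul r
    · fun_prop
    · rw [norm_mul, norm_pow, Complex.norm_exp]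
      gcongr
      rw [add_assoc, Complex.add_re, Complex.mul_conj, Complex.normSq_eq_norm_sq,
        Complex.re_mul_ofReal, Complex.neg_re]
      linarith [re_mul_add_mul_conj_le b c w]

lemma integral_cexp_neg_mul_conj {a : ℂ} (ha : 0 < a.re) (b c : ℂ) :
    ∫ w : ℂ, Complex.exp (-a * (w * conj w) + b * w + c * conj w)
      = Real.pi / a * Complex.exp (b * c / a) := by
  have ha0 : a ≠ 0 := by rintro rfl; simp at ha
  have h := GaussianFourier.integral_cexp_neg_mul_sum_add ha ![b + c, Complex.I * (b - c)]
  rw [← Complex.volume_preserving_equiv_pi.integral_comp'] at h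
  simp only [Fin.sum_univ_two, Complex.measurableEquivPi_apply, Matrix.cons_val_zero,
    Matrix.cons_val_one, Fintype.card_fin] at h
  refine (integral_congr_ae (.of_forall fun w ↦ ?_)).trans (h.trans ?_)
  · congr 1
    rw [Complex.mul_conj, Complex.normSq_apply]
    have hw : conj w = w.re - w.im * Complex.I := by apply Complex.ext <;> simp
    rw [hw]
    push_cast
    linear_combination (-b) * Complex.re_add_im w
  · rw [show ((Nat.succ 1 : ℕ) : ℂ) / 2 = 1 by norm_num, Complex.cpow_one]
    congr 2
    field_simp
    linear_combination (b - c) ^ 2 * Complex.I_sq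

lemma hasLineDerivAt_cexp_neg_mul_conj (a b c w v : ℂ) :
    HasLineDerivAt ℝ (fun w : ℂ ↦ Complex.exp (-a * (w * conj w) + b * w + c * conj w))
      (Complex.exp (-a * (w * conj w) + b * w + c * conj w) *
        (-a * (v * conj w + w * conj v) + b * v + c * conj v)) w v := by
  have h1 : HasFDerivAt (𝕜 := ℝ) (fun w : ℂ ↦ w) (.id ℝ ℂ) w := hasFDerivAt_id w
  have h2 : HasFDerivAt (𝕜 := ℝ) (fun w : ℂ ↦ conj w) (Complex.conjCLE : ℂ →L[ℝ] ℂ) w :=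
    Complex.conjCLE.hasFDerivAt
  convert! ((((h1.mul h2).const_mul (-a)).add (h1.const_mul b)).add
    (h2.const_mul c)).cexp.hasLineDerivAt v using 1
  simp
  ring

lemma integral_eval_mul_sub_mul_cexp {a : ℂ} (ha : 0 < a.re) (b c : ℂ) (p : ℂ[X]) :
    ∫ w : ℂ, p.eval w * (c - a * w) *
      Complex.exp (-a * (w * conj w) + b * w + c * conj w) = 0 := by
  set E : ℂ → ℂ := fun w ↦ Complex.exp (-a * (w * conj w) + b * w + c * conj w) with hE
  have hint (q : ℂ[X]) : Integrable fun w ↦ q.eval w * E w :=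
    integrable_eval_mul_cexp_neg_mul_conj ha b c q
  have hconj : Integrable fun w ↦ p.eval w * conj w * E w := by
    refine (hint (p * X)).mono (by fun_prop) (.of_forall fun w ↦ ?_)
    simp
  have hE' (v : ℂ) : Integrable fun w ↦
      p.eval w * (E w * (-a * (v * conj w + w * conj v) + b * v + c * conj v)) := by
    convert! (hconj.const_mul (-a * v)).add
      (hint (p * (C (-a * conj v) * X + C (b * v + c * conj v)))) using 2 with w
    simp
    ring
  have key (v : ℂ) :
      ∫ w, p.eval w * (E w * (-a * (v * conj w + w * conj v) + b * v + c * conj v))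
        = -(v * ∫ w, p.derivative.eval w * E w) := by
    rw [← integral_const_mul]
    simp only [← mul_assoc v]
    refine integral_bilinear_hasLineDerivAt_right_eq_neg_left_of_integrable
      (B := ContinuousLinearMap.mul ℝ ℂ) (v := v) (f := fun w ↦ p.eval w)
      (f' := fun w ↦ v * p.derivative.eval w) ?_ (hE' v) (hint p) ?_
      fun w _ ↦ hasLineDerivAt_cexp_neg_mul_conj a b c w v
    · simpa [mul_assoc] using (hint p.derivative).const_mul v
    · intro w _
      convert! ((p.hasDerivAt w).hasFDerivAt.restrictScalars ℝ).hasLineDerivAt v using 1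
  have h : (fun w ↦ p.eval w * (c - a * w) * E w) = fun w ↦
      1 / 2 * (p.eval w * (E w * (-a * (1 * conj w + w * conj 1) + b * 1 + c * conj 1)) +
      Complex.I * (p.eval w * (E w * (-a * (Complex.I * conj w + w * conj Complex.I)
        + b * Complex.I + c * conj Complex.I)))) := by
    ext w
    simp only [map_one, Complex.conj_I]
    linear_combination (-1/2 * p.eval w * E w * (-a * (conj w - w) + b - c)) * Complex.I_sq
  rw [h, integral_const_mul, integral_add (hE' 1) ((hE' _).const_mul _), integral_const_mul, key,
    key]
  linear_combination (-1/2 * ∫ w, p.derivative.eval w * E w) * Complex.I_sq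

/-- Holomorphic polynomials against a complex Gaussian are evaluated at its centre. -/
lemma integral_eval_mul_cexp_neg_mul_conj {a : ℂ} (ha : 0 < a.re) (b c : ℂ) (p : ℂ[X]) :
    ∫ w : ℂ, p.eval w * Complex.exp (-a * (w * conj w) + b * w + c * conj w)
      = Real.pi / a * p.eval (c / a) * Complex.exp (b * c / a) := by
  have ha0 : a ≠ 0 := by rintro rfl; simp at ha
  obtain ⟨q, hq⟩ := X_sub_C_dvd_sub_C_eval (a := c / a) (p := p)
  have hp (w : ℂ) : p.eval w = p.eval (c / a) + (C (-a⁻¹) * q).eval w * (c - a * w) := by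
    have := congrArg (eval w) hq
    simp only [eval_sub, eval_C, eval_mul, eval_X] at this ⊢
    rw [sub_eq_iff_eq_add.1 this]
    field
  have h1 := (integrable_eval_mul_cexp_neg_mul_conj ha b c 1).const_mul (p.eval (c / a))
  have h2 := integrable_eval_mul_cexp_neg_mul_conj ha b c (C (-a⁻¹) * q * (C c - C a * X))
  have h3 := integral_eval_mul_sub_mul_cexp ha b c (C (-a⁻¹) * q)
  simp only [eval_mul, eval_sub, eval_C, eval_X, eval_one, one_mul] at h1 h2 h3
  have hsplit (w : ℂ) : p.eval w * Complex.exp (-a * (w * conj w) + b * w + c * conj w) =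
      p.eval (c / a) * Complex.exp (-a * (w * conj w) + b * w + c * conj w) +
      -a⁻¹ * q.eval w * (c - a * w) * Complex.exp (-a * (w * conj w) + b * w + c * conj w) := by
    rw [hp w, eval_mul, eval_C]
    ring
  rw [integral_congr_ae (.of_forall hsplit), integral_add h1 h2, h3, integral_const_mul,
    integral_cexp_neg_mul_conj ha]
  ring

lemma exists_le_re_sesquilinear {α β γ δ : ℂ}
    (h : ∀ x y : ℂ, (x, y) ≠ 0 →
      0 < (α * (x * conj x) + β * (x * conj y) + γ * (y * conj x) + δ * (y * conj y)).re) :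
    ∃ ε > 0, ∀ x y : ℂ, ε * (‖x‖ ^ 2 + ‖y‖ ^ 2) ≤
      (α * (x * conj x) + β * (x * conj y) + γ * (y * conj x) + δ * (y * conj y)).re := by
  set f : ℂ × ℂ → ℝ := fun v ↦ (α * (v.1 * conj v.1) + β * (v.1 * conj v.2) +
    γ * (v.2 * conj v.1) + δ * (v.2 * conj v.2)).re with hf
  obtain ⟨u, hu, hmin⟩ := (isCompact_sphere (0 : ℂ × ℂ) 1).exists_isMinOn
    (NormedSpace.sphere_nonempty.2 zero_le_one) (f := f) (by fun_prop)
  have hu0 : u ≠ 0 := Metric.ne_of_mem_sphere hu one_ne_zero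
  have hfu : 0 < f u := h u.1 u.2 hu0
  refine ⟨f u / 2, by positivity, fun x y ↦ ?_⟩
  change _ ≤ f (x, y)
  rcases eq_or_ne (x, y) 0 with hxy | hxy
  · obtain ⟨rfl, rfl⟩ := Prod.mk_eq_zero.1 hxy
    simp [hf]
  have hr : 0 < ‖(x, y)‖ := norm_pos_iff.2 hxy
  set r := ‖(x, y)‖ with hr'
  have hs : r⁻¹ • (x, y) ∈ Metric.sphere (0 : ℂ × ℂ) 1 := by
    rw [mem_sphere_zero_iff_norm, norm_smul, norm_inv, Real.norm_of_nonneg hr.le, ← hr',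
      inv_mul_cancel₀ hr.ne']
  have hscale : f (r⁻¹ • (x, y)) = (r⁻¹) ^ 2 * f (x, y) := by
    simp only [hf, Prod.smul_mk, Complex.real_smul, map_mul, Complex.conj_ofReal]
    rw [← Complex.re_ofReal_mul]
    congr 1
    push_cast
    ring
  have hle : f u ≤ (r⁻¹) ^ 2 * f (x, y) := hscale ▸ hmin hs
  have hle' : f u * r ^ 2 ≤ f (x, y) := by
    rw [inv_pow, inv_mul_eq_div, le_div_iff₀ (by positivity)] at hle
    exact hle
  have hx : ‖x‖ ^ 2 ≤ r ^ 2 := by gcongr; exact norm_fst_le (x, y)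
  have hy : ‖y‖ ^ 2 ≤ r ^ 2 := by gcongr; exact norm_snd_le (x, y)
  nlinarith

lemma integrable_pow_mul_pow_mul_cexp_neg_sesquilinear {α β γ δ : ℂ}
    (h : ∀ x y : ℂ, (x, y) ≠ 0 →
      0 < (α * (x * conj x) + β * (x * conj y) + γ * (y * conj x) + δ * (y * conj y)).re)
    (b₀ b₁ c₀ c₁ : ℂ) (k₁ k₂ : ℕ) :
    Integrable fun v : ℂ × ℂ ↦ v.1 ^ k₁ * v.2 ^ k₂ *
      Complex.exp (-(α * (v.1 * conj v.1) + β * (v.1 * conj v.2) + γ * (v.2 * conj v.1) +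
        δ * (v.2 * conj v.2)) + (b₀ * v.1 + c₀ * conj v.1) + (b₁ * v.2 + c₁ * conj v.2)) := by
  obtain ⟨ε, hε, hle⟩ := exists_le_re_sesquilinear h
  refine ((integrable_norm_pow_mul_exp hε (‖b₀‖ + ‖c₀‖) k₁).mul_prod
    (integrable_norm_pow_mul_exp hε (‖b₁‖ + ‖c₁‖) k₂)).mono' (by fun_prop) (.of_forall fun v ↦ ?_)
  rw [norm_mul, norm_mul, norm_pow, norm_pow, Complex.norm_exp, mul_mul_mul_comm, ← Real.exp_add]
  refine mul_le_mul_of_nonneg_left (Real.exp_le_exp.2 ?_) (by positivity)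
  rw [Complex.add_re, Complex.add_re, Complex.neg_re]
  linarith [hle v.1 v.2, re_mul_add_mul_conj_le b₀ c₀ v.1, re_mul_add_mul_conj_le b₁ c₁ v.2]

lemma re_schur_complement_pos {α β γ δ : ℂ}
    (h : ∀ x y : ℂ, (x, y) ≠ 0 →
      0 < (α * (x * conj x) + β * (x * conj y) + γ * (y * conj x) + δ * (y * conj y)).re) :
    0 < α.re ∧ 0 < (δ - β * γ / α).re := by
  have hα : 0 < α.re := by simpa using h 1 0 (by simp)
  have hα0 : α ≠ 0 := by rintro rfl; simp at hα
  refine ⟨hα, ?_⟩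
  convert h (-γ / α) 1 (by simp) using 2
  simp only [map_one]
  field

/-- The Gaussian integral on `ℂ²` for a sesquilinear form with positive definite real part,
against a holomorphic monomial. -/
lemma integral_pow_mul_pow_mul_cexp_neg_sesquilinear {α β γ δ : ℂ}
    (h : ∀ x y : ℂ, (x, y) ≠ 0 →
      0 < (α * (x * conj x) + β * (x * conj y) + γ * (y * conj x) + δ * (y * conj y)).re)
    (b₀ b₁ c₀ c₁ : ℂ) (k₁ k₂ : ℕ) :
    ∫ v : ℂ × ℂ, v.1 ^ k₁ * v.2 ^ k₂ *
      Complex.exp (-(α * (v.1 * conj v.1) + β * (v.1 * conj v.2) + γ * (v.2 * conj v.1) +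
        δ * (v.2 * conj v.2)) + (b₀ * v.1 + c₀ * conj v.1) + (b₁ * v.2 + c₁ * conj v.2)) =
      Real.pi ^ 2 / (α * δ - β * γ) * ((c₀ * δ - c₁ * γ) / (α * δ - β * γ)) ^ k₁ *
        ((c₁ * α - c₀ * β) / (α * δ - β * γ)) ^ k₂ *
        Complex.exp (((c₀ * δ - c₁ * γ) * b₀ + (c₁ * α - c₀ * β) * b₁) / (α * δ - β * γ)) := by
  obtain ⟨hα, hS⟩ := re_schur_complement_pos h
  have hα0 : α ≠ 0 := by rintro rfl; simp at hα
  have hS0 : δ - β * γ / α ≠ 0 := by intro h; simp [h] at hS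
  have hD : α * δ - β * γ = α * (δ - β * γ / α) := by field
  have hD0 : α * δ - β * γ ≠ 0 := hD ▸ mul_ne_zero hα0 hS0
  have hx (y : ℂ) : ∫ x : ℂ, x ^ k₁ * y ^ k₂ *
      Complex.exp (-(α * (x * conj x) + β * (x * conj y) + γ * (y * conj x) +
        δ * (y * conj y)) + (b₀ * x + c₀ * conj x) + (b₁ * y + c₁ * conj y)) =
      Real.pi / α * Complex.exp (b₀ * c₀ / α) *
        ((X ^ k₂ * (C (c₀ / α) - C (γ / α) * X) ^ k₁ : ℂ[X]).eval y *
        Complex.exp (-(δ - β * γ / α) * (y * conj y) + (b₁ - b₀ * γ / α) * y +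
          (c₁ - c₀ * β / α) * conj y)) := by
    have := integral_eval_mul_cexp_neg_mul_conj hα (b₀ - β * conj y) (c₀ - γ * y) (X ^ k₁)
    simp only [eval_pow, eval_X] at this
    calc _ = ∫ x : ℂ, y ^ k₂ * Complex.exp (-δ * (y * conj y) + b₁ * y + c₁ * conj y) *
          (x ^ k₁ * Complex.exp (-α * (x * conj x) + (b₀ - β * conj y) * x +
            (c₀ - γ * y) * conj x)) := by
          congr 1 with x
          rw [mul_mul_mul_comm, ← Complex.exp_add, mul_comm (x ^ k₁)]
          congr 2
          ring
      _ = _ := by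
          rw [integral_const_mul, this]
          simp only [eval_mul, eval_pow, eval_sub, eval_C, eval_X]
          rw [show (c₀ - γ * y) / α = c₀ / α - γ / α * y by ring]
          have he : Complex.exp (-δ * (y * conj y) + b₁ * y + c₁ * conj y) *
              Complex.exp ((b₀ - β * conj y) * (c₀ - γ * y) / α) =
              Complex.exp (b₀ * c₀ / α) * Complex.exp (-(δ - β * γ / α) * (y * conj y) +
                (b₁ - b₀ * γ / α) * y + (c₁ - c₀ * β / α) * conj y) := by
            rw [← Complex.exp_add, ← Complex.exp_add]
            congr 1
            ring
          linear_combination (y ^ k₂ * (Real.pi / α) * (c₀ / α - γ / α * y) ^ k₁) * he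
  rw [Measure.volume_eq_prod, integral_prod_symm _
    (integrable_pow_mul_pow_mul_cexp_neg_sesquilinear h b₀ b₁ c₀ c₁ k₁ k₂)]
  simp only [hx]
  rw [integral_const_mul, integral_eval_mul_cexp_neg_mul_conj hS]
  simp only [eval_mul, eval_pow, eval_sub, eval_C, eval_X]
  have hy' : (c₁ - c₀ * β / α) / (δ - β * γ / α) = (c₁ * α - c₀ * β) / (α * δ - β * γ) := by
    rw [hD]
    field
  have hx' : c₀ / α - γ / α * ((c₁ * α - c₀ * β) / (α * δ - β * γ)) =
      (c₀ * δ - c₁ * γ) / (α * δ - β * γ) := by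
    rw [div_mul_div_comm, div_sub_div _ _ hα0 (mul_ne_zero hα0 hD0),
      div_eq_div_iff (mul_ne_zero hα0 (mul_ne_zero hα0 hD0)) hD0]
    ring
  have he : Complex.exp (b₀ * c₀ / α) *
      Complex.exp ((b₁ - b₀ * γ / α) * (c₁ - c₀ * β / α) / (δ - β * γ / α)) =
      Complex.exp (((c₀ * δ - c₁ * γ) * b₀ + (c₁ * α - c₀ * β) * b₁) / (α * δ - β * γ)) := by
    rw [← Complex.exp_add, mul_div_assoc (b₁ - _), hy']
    congr 1
    linear_combination b₀ * hx'
  have hπ : (Real.pi : ℂ) / α * (Real.pi / (δ - β * γ / α)) = Real.pi ^ 2 / (α * δ - β * γ) := by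
    rw [hD, div_mul_div_comm, sq]
  rw [hy', hx', ← he, ← hπ]
  ring

/-- Let `Z` be a `2 × 2` complex matrix with `i·(Zᴴ − Z)` positive
definite.  Then `Z` is invertible and for all `k₁ k₂ ∈ ℕ` and every row vector
`z ∈ ℂ²`:
`4·∫ w₁^{k₁} w₂^{k₂} e^{2πi Q_Z(w)} e^{−2πi(⟨w,z⟩+⟨z,w⟩)} dV(w)
  = det(i Z⁻¹)·u₁^{k₁} u₂^{k₂}·e^{−2πi Q_{Z⁻¹}(z)}`,
where `Q_M(w) = Σ_{j,l} wⱼ M_{jl} conj(w_l)`, `⟨w,z⟩ = Σⱼ wⱼ conj(zⱼ)`,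
`u = z·Z⁻¹`, and `V` is Lebesgue measure on `ℂ²`. -/
theorem stmt5 (Z : Matrix (Fin 2) (Fin 2) ℂ)
    (hZ : (Complex.I • (Zᴴ - Z)).PosDef) :
    IsUnit Z ∧
    ∀ (k₁ k₂ : ℕ) (z : Fin 2 → ℂ),
      4 * ∫ w : Fin 2 → ℂ,
          (w 0) ^ k₁ * (w 1) ^ k₂ *
            Complex.exp (2 * (Real.pi : ℂ) * Complex.I *
              ∑ j, ∑ l, w j * Z j l * (starRingEnd ℂ) (w l)) *
            Complex.exp (-(2 * (Real.pi : ℂ) * Complex.I) *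
              ((∑ j, w j * (starRingEnd ℂ) (z j)) + ∑ j, z j * (starRingEnd ℂ) (w j)))
        = (Complex.I • Z⁻¹).det *
            (Matrix.vecMul z Z⁻¹ 0) ^ k₁ * (Matrix.vecMul z Z⁻¹ 1) ^ k₂ *
            Complex.exp (-(2 * (Real.pi : ℂ) * Complex.I) *
              ∑ j, ∑ l, z j * Z⁻¹ j l * (starRingEnd ℂ) (z l)) := by
  have hpi : (Real.pi : ℂ) ≠ 0 := Complex.ofReal_ne_zero.2 Real.pi_ne_zero
  have hpos (x y : ℂ) (hxy : (x, y) ≠ 0) :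
      0 < (-(2 * Real.pi * Complex.I * Z 0 0) * (x * conj x) +
        -(2 * Real.pi * Complex.I * Z 0 1) * (x * conj y) +
        -(2 * Real.pi * Complex.I * Z 1 0) * (y * conj x) +
        -(2 * Real.pi * Complex.I * Z 1 1) * (y * conj y)).re := by
    have hv : ![conj x, conj y] ≠ 0 := by
      contrapose! hxy
      simpa using And.intro (congrFun hxy 0) (congrFun hxy 1)
    have h := (Complex.pos_iff.1 (hZ.dotProduct_mulVec_pos hv)).1
    refine (mul_pos Real.pi_pos h).trans_eq ?_
    simp [dotProduct, Matrix.mulVec, Fin.sum_univ_two]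
    ring
  obtain ⟨hα, hS⟩ := re_schur_complement_pos hpos
  have hdet : Z 0 0 * Z 1 1 - Z 0 1 * Z 1 0 ≠ 0 := by
    intro h0
    have hZ0 : Z 0 0 ≠ 0 := by intro h; simp [h] at hα
    apply hS.ne'
    rw [show Z 1 1 = Z 0 1 * Z 1 0 / Z 0 0 by field_simp; linear_combination h0]
    have : -(2 * Real.pi * Complex.I * (Z 0 1 * Z 1 0 / Z 0 0)) -
        -(2 * Real.pi * Complex.I * Z 0 1) * -(2 * Real.pi * Complex.I * Z 1 0) /
          -(2 * Real.pi * Complex.I * Z 0 0) = 0 := by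
      have := Complex.I_ne_zero
      field
    rw [this, Complex.zero_re]
  have hinv : Z⁻¹ = (Z 0 0 * Z 1 1 - Z 0 1 * Z 1 0)⁻¹ • !![Z 1 1, -Z 0 1; -Z 1 0, Z 0 0] := by
    rw [Matrix.inv_def, Matrix.det_fin_two, Matrix.adjugate_fin_two, Ring.inverse_eq_inv']
  refine ⟨(Matrix.isUnit_iff_isUnit_det Z).2 (by rw [Matrix.det_fin_two]; exact hdet.isUnit),
    fun k₁ k₂ z ↦ ?_⟩
  have key := integral_pow_mul_pow_mul_cexp_neg_sesquilinear hpos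
    (-(2 * Real.pi * Complex.I) * conj (z 0)) (-(2 * Real.pi * Complex.I) * conj (z 1))
    (-(2 * Real.pi * Complex.I) * z 0) (-(2 * Real.pi * Complex.I) * z 1) k₁ k₂
  rw [← (volume_preserving_finTwoArrow ℂ).integral_comp'] at key
  have hD : -(2 * Real.pi * Complex.I * Z 0 0) * -(2 * Real.pi * Complex.I * Z 1 1) -
      -(2 * Real.pi * Complex.I * Z 0 1) * -(2 * Real.pi * Complex.I * Z 1 0) =
      (2 * Real.pi * Complex.I) ^ 2 * (Z 0 0 * Z 1 1 - Z 0 1 * Z 1 0) := by ring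
  have hdiv (p q r t : ℂ) :
      (-(2 * Real.pi * Complex.I) * p * -(2 * Real.pi * Complex.I * q) -
        -(2 * Real.pi * Complex.I) * r * -(2 * Real.pi * Complex.I * t)) /
        ((2 * Real.pi * Complex.I) ^ 2 * (Z 0 0 * Z 1 1 - Z 0 1 * Z 1 0)) =
      (p * q - r * t) / (Z 0 0 * Z 1 1 - Z 0 1 * Z 1 0) := by
    rw [← mul_div_mul_left (p * q - r * t) _
      (pow_ne_zero 2 (by simp [hpi] : 2 * (Real.pi : ℂ) * Complex.I ≠ 0))]
    congr 1
    ring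
  rw [hD, add_div, mul_div_right_comm,
    mul_div_right_comm _ (-(2 * Real.pi * Complex.I) * conj (z 1)), hdiv, hdiv] at key
  have hu₀ : Matrix.vecMul z Z⁻¹ 0 =
      (z 0 * Z 1 1 - z 1 * Z 1 0) / (Z 0 0 * Z 1 1 - Z 0 1 * Z 1 0) := by
    simp [hinv, Matrix.vecMul, dotProduct]
    ring
  have hu₁ : Matrix.vecMul z Z⁻¹ 1 =
      (z 1 * Z 0 0 - z 0 * Z 0 1) / (Z 0 0 * Z 1 1 - Z 0 1 * Z 1 0) := by
    simp [hinv, Matrix.vecMul, dotProduct]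
    ring
  have hdetI : (Complex.I • Z⁻¹).det = 4 * (Real.pi ^ 2 / ((2 * Real.pi * Complex.I) ^ 2 *
      (Z 0 0 * Z 1 1 - Z 0 1 * Z 1 0))) := by
    rw [Matrix.det_smul, Matrix.det_nonsing_inv, Ring.inverse_eq_inv', Matrix.det_fin_two,
      Fintype.card_fin, mul_pow, mul_pow, Complex.I_sq]
    generalize Z 0 0 * Z 1 1 - Z 0 1 * Z 1 0 = d at *
    field
  have hexp : -(2 * Real.pi * Complex.I) * ∑ j, ∑ l, z j * Z⁻¹ j l * conj (z l) =
      -(2 * Real.pi * Complex.I) * (Matrix.vecMul z Z⁻¹ 0 * conj (z 0) +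
        Matrix.vecMul z Z⁻¹ 1 * conj (z 1)) := by
    simp [Fin.sum_univ_two, Matrix.vecMul, dotProduct]
    ring
  rw [hexp, hdetI, hu₀, hu₁]
  simp only [mul_assoc (4 : ℂ)]
  congr 1
  convert key using 1
  · congr 1 with w
    rw [mul_assoc, ← Complex.exp_add]
    simp only [MeasurableEquiv.finTwoArrow_apply, Fin.sum_univ_two]
    congr 2
    ring
  · congr 2
    ring
end

section
/- Let p be a prime, s > 0 a real number, and n ∈ ℕ. With respect to the Haar measure on ℚ_p normalized so that ℤ_p has measure 1: ∫_{{y ∈ ℚ_p : ‖y‖ ≥ p^{n+1}}} (−1)^{v(y)} · ‖y‖^{−2s−1} dy = −(−1)^n · p^{−2s(n+1)} · (1 − p⁻¹) / (1 + p^{−2s}), where v(y) denotes the p-adic valuation of y (every y in the domain of integration is nonzero) and ‖·‖ the p-adic absolute value. -/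
open MeasureTheory

/-- The `p`-adic ball of radius `p ^ k` is the union of `p ^ k` translates of `ℤ_p`. -/
lemma Padic.setOf_norm_le_pow_eq_biUnion (p : ℕ) [Fact p.Prime] (k : ℕ) :
    {x : ℚ_[p] | ‖x‖ ≤ (p : ℝ) ^ k} =
      ⋃ i ∈ Finset.range (p ^ k), (fun x : ℚ_[p] => x + -((i : ℚ_[p]) * (p : ℚ_[p])⁻¹ ^ k)) ⁻¹'
        {x : ℚ_[p] | ‖x‖ ≤ 1} := by
  have hp : 0 < (p : ℝ) := by exact_mod_cast (Fact.out : p.Prime).pos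
  have hpQ : (p : ℚ_[p]) ≠ 0 := by exact_mod_cast (Fact.out : p.Prime).ne_zero
  ext x
  simp only [Set.mem_ofPred_eq, Set.mem_iUnion, Set.mem_preimage, Finset.mem_range, exists_prop]
  constructor
  · intro hx
    have hz : ‖x * (p : ℚ_[p]) ^ k‖ ≤ 1 := by
      rw [norm_mul, norm_pow, Padic.norm_p, inv_pow]
      exact mul_inv_le_one_of_le₀ hx (by positivity)
    let z : ℤ_[p] := ⟨x * (p : ℚ_[p]) ^ k, hz⟩
    refine ⟨z.appr k, z.appr_lt k, ?_⟩
    have h := (PadicInt.norm_le_pow_iff_mem_span_pow _ k).2 (z.appr_spec k)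
    rw [PadicInt.norm_def] at h
    have hzc : ((z - (z.appr k : ℤ_[p]) : ℤ_[p]) : ℚ_[p]) =
        (x + -((z.appr k : ℚ_[p]) * (p : ℚ_[p])⁻¹ ^ k)) * (p : ℚ_[p]) ^ k := by
      push_cast
      rw [add_mul, neg_mul, mul_assoc, ← mul_pow, inv_mul_cancel₀ hpQ, one_pow, mul_one,
        sub_eq_add_neg]
    rw [hzc, norm_mul, norm_pow, Padic.norm_p, zpow_neg, zpow_natCast, ← inv_pow] at h
    exact (mul_le_iff_le_one_left (by positivity : 0 < (p : ℝ)⁻¹ ^ k)).1 (by simpa only [inv_pow] using h)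
  · rintro ⟨i, -, hi⟩
    have h1 : (1 : ℝ) ≤ (p : ℝ) ^ k :=
      one_le_pow₀ (by exact_mod_cast (Fact.out : p.Prime).one_le)
    have h2 : ‖(i : ℚ_[p]) * (p : ℚ_[p])⁻¹ ^ k‖ ≤ (p : ℝ) ^ k := by
      rw [norm_mul, norm_pow, norm_inv, Padic.norm_p, inv_inv]
      exact mul_le_of_le_one_left (by positivity) (by simpa using Padic.norm_int_le_one (p := p) i)
    have h := Padic.nonarchimedean (p := p)
      (x + -((i : ℚ_[p]) * (p : ℚ_[p])⁻¹ ^ k)) ((i : ℚ_[p]) * (p : ℚ_[p])⁻¹ ^ k)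
    rw [neg_add_cancel_right] at h
    exact h.trans (max_le (hi.trans h1) h2)

/-- The translates of `ℤ_p` by `i / p ^ k` for `i < p ^ k` are pairwise disjoint. -/
lemma Padic.pairwiseDisjoint_translates (p : ℕ) [Fact p.Prime] (k : ℕ) :
    (Finset.range (p ^ k) : Set ℕ).PairwiseDisjoint
      fun i : ℕ => (fun x : ℚ_[p] => x + -((i : ℚ_[p]) * (p : ℚ_[p])⁻¹ ^ k)) ⁻¹'
        {x : ℚ_[p] | ‖x‖ ≤ 1} := by
  have hp : 0 < (p : ℝ) := by exact_mod_cast (Fact.out : p.Prime).pos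
  intro i hi j hj hij
  refine Set.disjoint_left.2 fun x hxi hxj => hij ?_
  simp only [Set.mem_preimage, Set.mem_ofPred_eq, Finset.coe_range, Set.mem_Iio] at hxi hxj hi hj
  have h := Padic.nonarchimedean (p := p)
    (x + -((j : ℚ_[p]) * (p : ℚ_[p])⁻¹ ^ k)) (-(x + -((i : ℚ_[p]) * (p : ℚ_[p])⁻¹ ^ k)))
  rw [norm_neg] at h
  replace h := h.trans (max_le hxj hxi)
  have heq : x + -((j : ℚ_[p]) * (p : ℚ_[p])⁻¹ ^ k) + -(x + -((i : ℚ_[p]) * (p : ℚ_[p])⁻¹ ^ k))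
      = (((i : ℤ) - j : ℤ) : ℚ_[p]) * (p : ℚ_[p])⁻¹ ^ k := by
    push_cast
    ring
  rw [heq, norm_mul, norm_pow, norm_inv, Padic.norm_p, inv_inv] at h
  have h' : ‖(((i : ℤ) - j : ℤ) : ℚ_[p])‖ ≤ (p : ℝ) ^ (-(k : ℤ)) := by
    rw [zpow_neg, zpow_natCast, ← one_div]
    exact (le_div_iff₀ (by positivity)).2 h
  rw [Padic.norm_int_le_pow_iff_dvd] at h'
  have hmod : j ≡ i [MOD p ^ k] := by
    rw [Nat.modEq_iff_dvd]
    exact_mod_cast h'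
  exact (Nat.ModEq.eq_of_lt_of_lt hmod hj hi).symm

lemma Padic.measurableSet_norm_le (p : ℕ) [Fact p.Prime] [MeasurableSpace ℚ_[p]]
    [BorelSpace ℚ_[p]] (r : ℝ) : MeasurableSet {x : ℚ_[p] | ‖x‖ ≤ r} :=
  (isClosed_le continuous_norm continuous_const).measurableSet

/-- The `p`-adic ball of radius `p ^ k` has measure `p ^ k`. -/
lemma Padic.measure_norm_le_pow (p : ℕ) [Fact p.Prime]
    [MeasurableSpace ℚ_[p]] [BorelSpace ℚ_[p]]
    (μ : Measure ℚ_[p]) [μ.IsAddHaarMeasure]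
    (hμ : μ {x : ℚ_[p] | ‖x‖ ≤ 1} = 1) (k : ℕ) :
    μ {x : ℚ_[p] | ‖x‖ ≤ (p : ℝ) ^ k} = (p : ENNReal) ^ k := by
  rw [Padic.setOf_norm_le_pow_eq_biUnion, measure_biUnion_finset
    (Padic.pairwiseDisjoint_translates p k)
    fun i _ => (measurable_add_const _) (Padic.measurableSet_norm_le p 1)]
  simp only [measure_preimage_add_right, hμ]
  simp

/-- The measure of the `p`-adic sphere of radius `p ^ (k + 1)`. -/
lemma Padic.measureReal_norm_eq_pow_succ (p : ℕ) [Fact p.Prime]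
    [MeasurableSpace ℚ_[p]] [BorelSpace ℚ_[p]]
    (μ : Measure ℚ_[p]) [μ.IsAddHaarMeasure]
    (hμ : μ {x : ℚ_[p] | ‖x‖ ≤ 1} = 1) (k : ℕ) :
    μ.real {x : ℚ_[p] | ‖x‖ = (p : ℝ) ^ (k + 1)} = (p : ℝ) ^ (k + 1) * (1 - (p : ℝ)⁻¹) := by
  have hp : (p : ℝ) ≠ 0 := by exact_mod_cast (Fact.out : p.Prime).ne_zero
  have hp1 : (1 : ℝ) ≤ p := by exact_mod_cast (Fact.out : p.Prime).one_le
  have hS : {x : ℚ_[p] | ‖x‖ = (p : ℝ) ^ (k + 1)} =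
      {x : ℚ_[p] | ‖x‖ ≤ (p : ℝ) ^ (k + 1)} \ {x : ℚ_[p] | ‖x‖ ≤ (p : ℝ) ^ k} := by
    ext x
    have h := Padic.norm_le_pow_iff_norm_lt_pow_add_one x k
    norm_cast at h
    simp only [Set.mem_ofPred_eq, Set.mem_sdiff]
    push_cast at h
    rw [h, not_lt]
    exact le_antisymm_iff
  have hsub : {x : ℚ_[p] | ‖x‖ ≤ (p : ℝ) ^ k} ⊆ {x : ℚ_[p] | ‖x‖ ≤ (p : ℝ) ^ (k + 1)} :=
    fun x (hx : ‖x‖ ≤ _) => hx.trans (pow_le_pow_right₀ hp1 k.le_succ)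
  rw [hS, measureReal_sdiff hsub
    (Padic.measurableSet_norm_le p _)
    (by rw [Padic.measure_norm_le_pow p μ hμ]; finiteness),
    Measure.real, Measure.real,
    Padic.measure_norm_le_pow p μ hμ, Padic.measure_norm_le_pow p μ hμ]
  simp only [ENNReal.toReal_pow, ENNReal.toReal_natCast]
  field_simp
  ring

/-- Let `p` be prime, `s > 0` real and `n ∈ ℕ`.  With respect to
the (additive) Haar measure on `ℚ_p` normalized so that `ℤ_p` has measure `1`:
`∫_{‖y‖ ≥ p^{n+1}} (−1)^{v(y)}·‖y‖^{−2s−1} dy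
  = −(−1)^n · p^{−2s(n+1)} · (1 − p⁻¹)/(1 + p^{−2s})`,
where `v` is the `p`-adic valuation. -/
theorem stmt7 (p : ℕ) [Fact p.Prime] (s : ℝ) (hs : 0 < s) (n : ℕ)
    [MeasurableSpace ℚ_[p]] [BorelSpace ℚ_[p]]
    (μ : Measure ℚ_[p]) [μ.IsAddHaarMeasure]
    (hμ : μ {x : ℚ_[p] | ‖x‖ ≤ 1} = 1) :
    ∫ y in {y : ℚ_[p] | (p : ℝ) ^ (n + 1) ≤ ‖y‖},
        (-1 : ℝ) ^ y.valuation * ‖y‖ ^ (-2 * s - 1) ∂μ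
      = -(-1 : ℝ) ^ n * (p : ℝ) ^ (-2 * s * ((n : ℝ) + 1)) *
          (1 - (p : ℝ)⁻¹) / (1 + (p : ℝ) ^ (-2 * s)) := by
  have hp1 : (1 : ℝ) < p := by exact_mod_cast (Fact.out : p.Prime).one_lt
  have hp : (0 : ℝ) < p := by linarith
  set q : ℝ := (p : ℝ) ^ (-2 * s) with hq
  have hq0 : 0 < q := Real.rpow_pos_of_pos hp _
  have hq1 : q < 1 := Real.rpow_lt_one_of_one_lt_of_neg hp1 (by linarith)
  have hpow (k : ℕ) : ((p : ℝ) ^ k) ^ (-2 * s - 1) * (p : ℝ) ^ k = q ^ k := by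
    rw [← Real.rpow_add_one (by positivity), sub_add_cancel, hq, ← Real.rpow_natCast,
      ← Real.rpow_natCast, ← Real.rpow_mul hp.le, ← Real.rpow_mul hp.le, mul_comm]
  let S : ℕ → Set ℚ_[p] := fun j => {y | ‖y‖ = (p : ℝ) ^ (n + j + 1)}
  have hSm (j : ℕ) : MeasurableSet (S j) :=
    (isClosed_eq continuous_norm continuous_const).measurableSet
  have hSdisj : Pairwise (Function.onFun Disjoint S) := by
    intro i j hij
    refine Set.disjoint_left.2 fun x hi hj => hij ?_
    have h := pow_right_injective₀ hp hp1.ne' (hi.symm.trans hj)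
    omega
  have hSU : {y : ℚ_[p] | (p : ℝ) ^ (n + 1) ≤ ‖y‖} = ⋃ j, S j := by
    ext y
    simp only [Set.mem_ofPred_eq, Set.mem_iUnion, S]
    constructor
    · intro hy
      have hy0 : y ≠ 0 := norm_pos_iff.1 (lt_of_lt_of_le (by positivity) hy)
      rw [Padic.norm_eq_zpow_neg_valuation hy0] at hy ⊢
      rw [← zpow_natCast, zpow_le_zpow_iff_right₀ hp1] at hy
      refine ⟨(-y.valuation - (n + 1)).toNat, ?_⟩
      rw [← zpow_natCast]
      congr 1
      push_cast at hy ⊢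
      omega
    · rintro ⟨j, hj⟩
      rw [hj]
      exact pow_le_pow_right₀ hp1.le (by omega)
  have hval (j : ℕ) (y : ℚ_[p]) (hy : y ∈ S j) : (-1 : ℝ) ^ y.valuation = (-1) ^ (n + j + 1) := by
    have hy' : ‖y‖ = (p : ℝ) ^ (n + j + 1) := hy
    have hy0 : y ≠ 0 := norm_pos_iff.1 (by rw [hy']; positivity)
    rw [Padic.norm_eq_zpow_neg_valuation hy0, ← zpow_natCast] at hy'
    have h := zpow_right_injective₀ hp hp1.ne' hy'
    rw [← neg_neg y.valuation, show -y.valuation = _ from h, zpow_neg, zpow_natCast, ← inv_pow]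
    norm_num
  have hEq (j : ℕ) : Set.EqOn (fun y : ℚ_[p] => (-1 : ℝ) ^ y.valuation * ‖y‖ ^ (-2 * s - 1))
      (fun _ => (-1) ^ (n + j + 1) * ((p : ℝ) ^ (n + j + 1)) ^ (-2 * s - 1)) (S j) := by
    intro y hy
    simp only [hval j y hy, show ‖y‖ = _ from hy]
  have hSfin (j : ℕ) : μ (S j) ≠ ⊤ := by
    have hsub : S j ⊆ {y : ℚ_[p] | ‖y‖ ≤ (p : ℝ) ^ (n + j + 1)} := fun y (hy : ‖y‖ = _) => hy.le
    refine ne_top_of_le_ne_top ?_ (measure_mono hsub)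
    rw [Padic.measure_norm_le_pow p μ hμ]
    finiteness
  have hSreal (j : ℕ) : μ.real (S j) = _ := Padic.measureReal_norm_eq_pow_succ p μ hμ (n + j)
  have hint (j : ℕ) : ∫ y in S j, (-1 : ℝ) ^ y.valuation * ‖y‖ ^ (-2 * s - 1) ∂μ =
      (-(-1) ^ n * q ^ (n + 1) * (1 - (p : ℝ)⁻¹)) * (-q) ^ j := by
    rw [setIntegral_congr_fun (hSm j) (hEq j), setIntegral_const, hSreal, smul_eq_mul]
    have h := hpow (n + j + 1)
    calc _ = (-1) ^ (n + j + 1) * (1 - (p : ℝ)⁻¹) *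
          (((p : ℝ) ^ (n + j + 1)) ^ (-2 * s - 1) * (p : ℝ) ^ (n + j + 1)) := by ring
      _ = _ := by rw [h, neg_pow q]; ring
  have hnorm (j : ℕ) : ∫ y in S j, ‖(-1 : ℝ) ^ y.valuation * ‖y‖ ^ (-2 * s - 1)‖ ∂μ =
      (q ^ (n + 1) * (1 - (p : ℝ)⁻¹)) * q ^ j := by
    rw [setIntegral_congr_fun (hSm j) fun y hy => congrArg norm (hEq j hy), setIntegral_const,
      hSreal, smul_eq_mul, norm_mul, norm_pow, norm_neg, norm_one, one_pow, one_mul,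
      Real.norm_of_nonneg (by positivity)]
    have h := hpow (n + j + 1)
    calc _ = (1 - (p : ℝ)⁻¹) *
          (((p : ℝ) ^ (n + j + 1)) ^ (-2 * s - 1) * (p : ℝ) ^ (n + j + 1)) := by ring
      _ = _ := by rw [h]; ring
  have hsum : IntegrableOn (fun y : ℚ_[p] => (-1 : ℝ) ^ y.valuation * ‖y‖ ^ (-2 * s - 1))
      (⋃ j, S j) μ := by
    refine integrableOn_iUnion_of_summable_integral_norm (fun j => ?_) ?_
    · exact (integrableOn_const (hSfin j)).congr_fun (hEq j).symm (hSm j)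
    · simp only [hnorm]
      exact (summable_geometric_of_lt_one hq0.le hq1).mul_left _
  rw [hSU, integral_iUnion hSm hSdisj hsum]
  simp only [hint]
  rw [tsum_mul_left, tsum_geometric_of_norm_lt_one (by rwa [norm_neg, Real.norm_of_nonneg hq0.le]),
    Real.rpow_mul hp.le, ← hq, ← Nat.cast_succ, Real.rpow_natCast, sub_neg_eq_add, div_eq_mul_inv]
end

section
/- Let p be a prime and a₁, a₂, b₁, b₂ ∈ ℚ_p. Then Σ_{m ∈ ℤ} 1_{ℤ_pˣ}(p^{−m}·a₁)·1_{ℤ_pˣ}(p^{m}·b₁)·1_{ℤ_pˣ}(p^{−m}·a₂)·1_{ℤ_pˣ}(p^{m}·b₂) (a sum with at most one nonzero term) equals 1 if all four products a₁b₁, a₁b₂, a₂b₁, a₂b₂ lie in ℤ_pˣ, and equals 0 otherwise. In particular, when all four products are units there is a unique m ∈ ℤ with p^{−m}a₁, p^{−m}a₂, p^{m}b₁, p^{m}b₂ all in ℤ_pˣ. -/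
open scoped Classical

theorem Padic.norm_eq_one_iff_valuation {p : ℕ} [Fact p.Prime] (x : ℚ_[p]) :
    ‖x‖ = 1 ↔ x ≠ 0 ∧ x.valuation = 0 := by
  have hp : (1 : ℝ) < p := by exact_mod_cast (Fact.out : p.Prime).one_lt
  by_cases hx : x = 0
  · simp [hx]
  · rw [Padic.norm_eq_zpow_neg_valuation hx, zpow_eq_one_iff_right₀ (by positivity) hp.ne']
    simp [hx]

theorem Padic.norm_mul_eq_one_iff_valuation {p : ℕ} [Fact p.Prime] (x y : ℚ_[p]) :
    ‖x * y‖ = 1 ↔ x ≠ 0 ∧ y ≠ 0 ∧ x.valuation + y.valuation = 0 := by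
  rw [Padic.norm_eq_one_iff_valuation, mul_ne_zero_iff, and_assoc]
  refine and_congr_right fun hx => and_congr_right fun hy => ?_
  rw [Padic.valuation_mul hx hy]

theorem Padic.norm_p_zpow_mul_eq_one_iff {p : ℕ} [Fact p.Prime] (m : ℤ) (x : ℚ_[p]) :
    ‖(p : ℚ_[p]) ^ m * x‖ = 1 ↔ x ≠ 0 ∧ m + x.valuation = 0 := by
  have hp : (p : ℚ_[p]) ≠ 0 := by exact_mod_cast (Fact.out : p.Prime).ne_zero
  rw [Padic.norm_mul_eq_one_iff_valuation, Padic.valuation_zpow, Padic.valuation_p, mul_one]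
  simp [zpow_ne_zero m hp]

/-- A power of `p` rescaling all four numbers to units exists exactly when all the products are
units, and it is then determined by the valuation of `a₁`. -/
theorem Padic.norm_rescaled_eq_one_iff {p : ℕ} [Fact p.Prime] (a₁ a₂ b₁ b₂ : ℚ_[p]) (m : ℤ) :
    (‖(p : ℚ_[p]) ^ (-m) * a₁‖ = 1 ∧ ‖(p : ℚ_[p]) ^ (-m) * a₂‖ = 1 ∧
        ‖(p : ℚ_[p]) ^ m * b₁‖ = 1 ∧ ‖(p : ℚ_[p]) ^ m * b₂‖ = 1) ↔
      (‖a₁ * b₁‖ = 1 ∧ ‖a₁ * b₂‖ = 1 ∧ ‖a₂ * b₁‖ = 1 ∧ ‖a₂ * b₂‖ = 1) ∧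
        m = a₁.valuation := by
  simp only [Padic.norm_p_zpow_mul_eq_one_iff]
  simp only [Padic.norm_mul_eq_one_iff_valuation]
  constructor
  · rintro ⟨⟨h₁, _⟩, ⟨h₂, _⟩, ⟨h₃, _⟩, h₄, _⟩
    refine ⟨⟨⟨h₁, h₃, ?_⟩, ⟨h₁, h₄, ?_⟩, ⟨h₂, h₃, ?_⟩, h₂, h₄, ?_⟩, ?_⟩ <;> lia
  · rintro ⟨⟨⟨h₁, h₃, _⟩, ⟨_, h₄, _⟩, ⟨h₂, _, _⟩, _⟩, _⟩
    refine ⟨⟨h₁, ?_⟩, ⟨h₂, ?_⟩, ⟨h₃, ?_⟩, h₄, ?_⟩ <;> lia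

/-- For a prime `p` and `a₁, a₂, b₁, b₂ ∈ ℚ_p`, the sum
`Σ_{m∈ℤ} 1_{ℤ_pˣ}(p^{−m}a₁)·1_{ℤ_pˣ}(p^m b₁)·1_{ℤ_pˣ}(p^{−m}a₂)·1_{ℤ_pˣ}(p^m b₂)`
(having at most one nonzero term) equals `1` if all of `a₁b₁, a₁b₂, a₂b₁, a₂b₂`
are units of `ℤ_p`, and `0` otherwise; and when all four products are units there
is a unique such `m`. -/
theorem stmt9 (p : ℕ) [Fact p.Prime] (a₁ a₂ b₁ b₂ : ℚ_[p]) :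
    let term : ℤ → ℝ := fun m =>
      (if ‖(p : ℚ_[p]) ^ (-m) * a₁‖ = 1 then 1 else 0) *
        (if ‖(p : ℚ_[p]) ^ m * b₁‖ = 1 then 1 else 0) *
        (if ‖(p : ℚ_[p]) ^ (-m) * a₂‖ = 1 then 1 else 0) *
        (if ‖(p : ℚ_[p]) ^ m * b₂‖ = 1 then 1 else 0)
    (Function.support term).Subsingleton ∧
      (∑' m : ℤ, term m) =
        (if ‖a₁ * b₁‖ = 1 ∧ ‖a₁ * b₂‖ = 1 ∧ ‖a₂ * b₁‖ = 1 ∧ ‖a₂ * b₂‖ = 1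
          then 1 else 0) ∧
      ((‖a₁ * b₁‖ = 1 ∧ ‖a₁ * b₂‖ = 1 ∧ ‖a₂ * b₁‖ = 1 ∧ ‖a₂ * b₂‖ = 1) →
        ∃! m : ℤ, ‖(p : ℚ_[p]) ^ (-m) * a₁‖ = 1 ∧ ‖(p : ℚ_[p]) ^ (-m) * a₂‖ = 1 ∧
          ‖(p : ℚ_[p]) ^ m * b₁‖ = 1 ∧ ‖(p : ℚ_[p]) ^ m * b₂‖ = 1) := by
  intro term
  have key := Padic.norm_rescaled_eq_one_iff a₁ a₂ b₁ b₂
  set P := ‖a₁ * b₁‖ = 1 ∧ ‖a₁ * b₂‖ = 1 ∧ ‖a₂ * b₁‖ = 1 ∧ ‖a₂ * b₂‖ = 1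
  have hterm : ∀ m, term m = if P ∧ m = a₁.valuation then 1 else 0 := by
    intro m
    simp only [← key m, term, ite_zero_mul_ite_zero, mul_one]
    exact if_congr (by tauto) rfl rfl
  refine ⟨?_, ?_, fun h => ⟨a₁.valuation, (key _).2 ⟨h, rfl⟩, fun m hm => ((key m).1 hm).2⟩⟩
  · have hsupp : ∀ m ∈ Function.support term, m = a₁.valuation := by
      intro m hm
      rw [Function.mem_support, hterm] at hm
      exact (ite_ne_right_iff.1 hm).1.2
    exact fun m hm n hn => (hsupp m hm).trans (hsupp n hn).symm
  · rw [tsum_eq_single a₁.valuation fun m hm => by rw [hterm, if_neg fun h => hm h.2], hterm]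
    exact if_congr (and_iff_left rfl) rfl rfl
end

section
/- Let p be a prime and a₁, a₂ ∈ ℚ_p. Then Σ_{b=0}^{p−1} 1_{ℤ_pˣ}(p·a₁)·1_{ℤ_p}(b·a₁ + a₂) = 1_{ℤ_pˣ}(p·a₁)·1_{ℤ_p}(p·a₂), where b is regarded in ℚ_p via the canonical map ℕ → ℚ_p. -/
/-- The number of approximations modulo `p` of a `p`-adic number in `{0, …, p - 1}` is given by the
indicator of `ℤ_p`: one if it is integral and none otherwise. -/
theorem Padic.sum_range_ite_norm_sub_lt_one (p : ℕ) [Fact p.Prime] (x : ℚ_[p]) :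
    (∑ b ∈ Finset.range p, if ‖x - b‖ < 1 then (1 : ℝ) else 0) = if ‖x‖ ≤ 1 then 1 else 0 := by
  split_ifs with hx
  · obtain ⟨x, rfl⟩ : ∃ y : ℤ_[p], (y : ℚ_[p]) = x := ⟨⟨x, hx⟩, rfl⟩
    have hmem (b : ℕ) : x - b ∈ IsLocalRing.maximalIdeal ℤ_[p] ↔ ‖(x : ℚ_[p]) - b‖ < 1 := by
      rw [IsLocalRing.mem_maximalIdeal, PadicInt.mem_nonunits, PadicInt.norm_def]
      push_cast
      rfl
    obtain ⟨n, ⟨hn, hxn⟩, huniq⟩ := PadicInt.existsUnique_mem_range x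
    rw [Finset.sum_eq_single n, if_pos ((hmem n).1 hxn)]
    · intro b hb hbn
      exact if_neg fun h => hbn (huniq b ⟨Finset.mem_range.1 hb, (hmem b).2 h⟩)
    · exact fun h => absurd (Finset.mem_range.2 hn) h
  · refine Finset.sum_eq_zero fun b _ => if_neg fun h => hx ?_
    have hadd := Padic.nonarchimedean (x - (b : ℚ_[p])) b
    rw [sub_add_cancel] at hadd
    exact hadd.trans (max_le h.le (by simpa using Padic.norm_int_le_one (p := p) (b : ℤ)))

/-- For a prime `p` and `a₁, a₂ ∈ ℚ_p`:
`Σ_{b=0}^{p−1} 1_{ℤ_pˣ}(p·a₁)·1_{ℤ_p}(b·a₁ + a₂) = 1_{ℤ_pˣ}(p·a₁)·1_{ℤ_p}(p·a₂)`. -/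
theorem stmt10 (p : ℕ) [Fact p.Prime] (a₁ a₂ : ℚ_[p]) :
    (∑ b ∈ Finset.range p,
        (if ‖(p : ℚ_[p]) * a₁‖ = 1 then (1 : ℝ) else 0) *
          (if ‖(b : ℚ_[p]) * a₁ + a₂‖ ≤ 1 then 1 else 0))
      = (if ‖(p : ℚ_[p]) * a₁‖ = 1 then (1 : ℝ) else 0) *
          (if ‖(p : ℚ_[p]) * a₂‖ ≤ 1 then 1 else 0) := by
  rw [← Finset.mul_sum]
  by_cases h : ‖(p : ℚ_[p]) * a₁‖ = 1
  swap
  · rw [if_neg h, zero_mul, zero_mul]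
  congr 1
  have hp : (0 : ℝ) < p := by exact_mod_cast (Fact.out : p.Prime).pos
  have ha₁ : ‖a₁‖ = p := by
    rw [norm_mul, Padic.norm_p] at h
    field_simp at h
    exact h
  have h0 : a₁ ≠ 0 := norm_pos_iff.1 (ha₁ ▸ hp)
  have hnorm : ‖-a₂ / a₁‖ = ‖(p : ℚ_[p]) * a₂‖ := by
    rw [norm_div, norm_neg, norm_mul, Padic.norm_p, ha₁, div_eq_inv_mul]
  have hiff (b : ℕ) : ‖(b : ℚ_[p]) * a₁ + a₂‖ ≤ 1 ↔ ‖-a₂ / a₁ - b‖ < 1 := by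
    have hb : -a₂ / a₁ - b = -((b * a₁ + a₂) / a₁) := by
      field_simp
      ring
    rw [hb, norm_neg, norm_div, ha₁, div_lt_one hp]
    simpa using Padic.norm_le_pow_iff_norm_lt_pow_add_one ((b : ℚ_[p]) * a₁ + a₂) 0
  simp_rw [hiff]
  rw [Padic.sum_range_ite_norm_sub_lt_one, hnorm]
end

section
/- Let p be a prime and a₁, a₂ ∈ ℚ_p. Then Σ_{b=0}^{p−1} 1_{ℤ_p}(p·a₁)·1_{ℤ_p}(b·a₁ + a₂) + 1_{ℤ_p}(a₁)·1_{ℤ_p}(p·a₂) = 1_{ℤ_p}(p·a₁)·1_{ℤ_p}(p·a₂) + p·1_{ℤ_p}(a₁)·1_{ℤ_p}(a₂), where b is regarded in ℚ_p via the canonical map ℕ → ℚ_p. -/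
/-- An element of `ℚ_p` is integral iff its multiple by `p` has norm less than one. -/
theorem Padic.norm_p_mul_lt_one_iff {p : ℕ} [Fact p.Prime] (a : ℚ_[p]) :
    ‖(p : ℚ_[p]) * a‖ < 1 ↔ ‖a‖ ≤ 1 := by
  have hp : (0 : ℝ) < p := by exact_mod_cast (Fact.out : p.Prime).pos
  have h := Padic.norm_le_pow_iff_norm_lt_pow_add_one a 0
  simp only [zpow_zero, zero_add, zpow_one] at h
  rw [h, norm_mul, Padic.norm_p, inv_mul_lt_iff₀ hp, mul_one]

theorem Padic.norm_natCast_mul_le_one {p : ℕ} [Fact p.Prime] (n : ℕ) {a : ℚ_[p]}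
    (ha : ‖a‖ ≤ 1) : ‖(n : ℚ_[p]) * a‖ ≤ 1 := by
  rw [norm_mul]
  exact mul_le_one₀ (by simpa using Padic.norm_int_le_one (p := p) n) (norm_nonneg _) ha

/-- Adding an integral element does not change integrality. -/
theorem Padic.norm_add_le_one_iff {p : ℕ} [Fact p.Prime] {a : ℚ_[p]} (ha : ‖a‖ ≤ 1)
    (c : ℚ_[p]) : ‖a + c‖ ≤ 1 ↔ ‖c‖ ≤ 1 := by
  refine ⟨fun h => ?_, fun h => (Padic.nonarchimedean a c).trans (max_le ha h)⟩
  have h' := Padic.nonarchimedean (a + c) (-a)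
  rw [norm_neg, add_neg_cancel_comm] at h'
  exact h'.trans (max_le h ha)

/-- If `u` is a unit and `v` is integral then `b * u + v` is a nonunit for exactly one residue
`b < p`. -/
theorem Padic.existsUnique_norm_natCast_mul_add_lt_one {p : ℕ} [Fact p.Prime] {u v : ℚ_[p]}
    (hu : ‖u‖ = 1) (hv : ‖v‖ ≤ 1) : ∃! b : ℕ, b < p ∧ ‖(b : ℚ_[p]) * u + v‖ < 1 := by
  have hu0 : u ≠ 0 := norm_ne_zero_iff.mp (by simp [hu])
  let x : ℤ_[p] := ⟨-v / u, by simpa [hu] using hv⟩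
  have key (b : ℕ) : x - b ∈ IsLocalRing.maximalIdeal ℤ_[p] ↔ ‖(b : ℚ_[p]) * u + v‖ < 1 := by
    have hx : (b : ℚ_[p]) * u + v = -(((x - b : ℤ_[p]) : ℚ_[p]) * u) := by
      rw [PadicInt.coe_sub, PadicInt.coe_natCast, sub_mul, show (x : ℚ_[p]) * u = -v from
        div_mul_cancel₀ _ hu0]
      ring
    rw [IsLocalRing.mem_maximalIdeal, PadicInt.mem_nonunits, hx, norm_neg, norm_mul, hu, mul_one,
      PadicInt.norm_def]
  simpa only [key] using PadicInt.existsUnique_mem_range x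

/-- For a prime `p` and `a₁, a₂ ∈ ℚ_p`:
`Σ_{b=0}^{p−1} 1_{ℤ_p}(p·a₁)·1_{ℤ_p}(b·a₁+a₂) + 1_{ℤ_p}(a₁)·1_{ℤ_p}(p·a₂)
  = 1_{ℤ_p}(p·a₁)·1_{ℤ_p}(p·a₂) + p·1_{ℤ_p}(a₁)·1_{ℤ_p}(a₂)`. -/
theorem stmt11 (p : ℕ) [Fact p.Prime] (a₁ a₂ : ℚ_[p]) :
    (∑ b ∈ Finset.range p,
        (if ‖(p : ℚ_[p]) * a₁‖ ≤ 1 then (1 : ℝ) else 0) *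
          (if ‖(b : ℚ_[p]) * a₁ + a₂‖ ≤ 1 then 1 else 0)) +
      (if ‖a₁‖ ≤ 1 then (1 : ℝ) else 0) * (if ‖(p : ℚ_[p]) * a₂‖ ≤ 1 then 1 else 0)
      = (if ‖(p : ℚ_[p]) * a₁‖ ≤ 1 then (1 : ℝ) else 0) *
          (if ‖(p : ℚ_[p]) * a₂‖ ≤ 1 then 1 else 0) +
        (p : ℝ) * ((if ‖a₁‖ ≤ 1 then (1 : ℝ) else 0) * (if ‖a₂‖ ≤ 1 then 1 else 0)) := by
  by_cases h1 : ‖a₁‖ ≤ 1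
  · have hb (b : ℕ) : ‖(b : ℚ_[p]) * a₁ + a₂‖ ≤ 1 ↔ ‖a₂‖ ≤ 1 :=
      Padic.norm_add_le_one_iff (Padic.norm_natCast_mul_le_one b h1) a₂
    simp only [h1, Padic.norm_natCast_mul_le_one p h1, hb, if_true, one_mul, Finset.sum_const,
      Finset.card_range, nsmul_eq_mul]
    ring
  by_cases hp1 : ‖(p : ℚ_[p]) * a₁‖ ≤ 1
  · simp only [h1, hp1, if_true, if_false, one_mul, zero_mul, mul_zero, add_zero]
    have hu : ‖(p : ℚ_[p]) * a₁‖ = 1 :=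
      le_antisymm hp1 (not_lt.mp (mt (Padic.norm_p_mul_lt_one_iff a₁).mp h1))
    have hb (b : ℕ) : ‖(b : ℚ_[p]) * a₁ + a₂‖ ≤ 1 ↔
        ‖(b : ℚ_[p]) * ((p : ℚ_[p]) * a₁) + (p : ℚ_[p]) * a₂‖ < 1 := by
      rw [← Padic.norm_p_mul_lt_one_iff, mul_add, mul_left_comm]
    simp only [hb]
    split_ifs with hp2
    · obtain ⟨c, ⟨hcp, hc⟩, huniq⟩ := Padic.existsUnique_norm_natCast_mul_add_lt_one hu hp2
      rw [Finset.sum_eq_single_of_mem c (Finset.mem_range.mpr hcp), if_pos hc]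
      exact fun b hbp hbc => if_neg fun h => hbc (huniq b ⟨Finset.mem_range.mp hbp, h⟩)
    · refine Finset.sum_eq_zero fun b _ => if_neg fun h => hp2 ?_
      exact (Padic.norm_add_le_one_iff (Padic.norm_natCast_mul_le_one b hp1) _).mp h.le
  · simp only [h1, hp1, if_false, zero_mul, mul_zero, add_zero, Finset.sum_const_zero]
end

section
/- Let k ∈ ℕ and let R be a commutative ℚ-algebra. On the R-module L_k of homogeneous polynomials of degree k in two variables X, Y over R, define a bilinear pairing by ⟨X^i Y^{k−i}, X^j Y^{k−j}⟩_k = (−1)^i · binom(k,i)⁻¹ if i + j = k, and 0 otherwise, and for a 2×2 matrix g = [[a,b],[c,d]] over R let ρ(g) act on L_k by (ρ(g)P)(X,Y) = P(aX + cY, bX + dY) (substitution of the row vector (X,Y)·g). Then for all g ∈ M₂(R) and all P, Q ∈ L_k: ⟨ρ(g)P, Q⟩_k = ⟨P, ρ(g′)Q⟩_k, where g′ = [[d, −b],[−c, a]] is the adjugate of g. Moreover ⟨P, Q⟩_k = (−1)^k · ⟨Q, P⟩_k for all P, Q ∈ L_k. -/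
open MvPolynomial

/-- The space `L_k` of homogeneous polynomials of degree `k` in two variables
`X = X 0`, `Y = X 1`, realized inside `MvPolynomial (Fin 2) R`. -/
noncomputable def Lk (R : Type*) [CommRing R] (k : ℕ) :
    Submodule R (MvPolynomial (Fin 2) R) :=
  MvPolynomial.homogeneousSubmodule (Fin 2) R k

/-- The substitution action `(ρ(g)P)(X,Y) = P((X,Y)·g)` of a `2 × 2` matrix. -/
noncomputable def rho {R : Type*} [CommRing R] (g : Matrix (Fin 2) (Fin 2) R)
    (P : MvPolynomial (Fin 2) R) : MvPolynomial (Fin 2) R :=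
  MvPolynomial.aeval (fun i => ∑ j, MvPolynomial.X j * MvPolynomial.C (g j i)) P

/-- The exponent of the monomial `X^i Y^(k-i)`. -/
noncomputable def expo (k i : ℕ) : Fin 2 →₀ ℕ :=
  Finsupp.single 0 i + Finsupp.single 1 (k - i)

/-- The bilinear pairing on `L_k` determined by
`⟨X^i Y^(k−i), X^j Y^(k−j)⟩ = (−1)^i · (k choose i)⁻¹` when `i + j = k`
and `0` otherwise. -/
noncomputable def pairB (k : ℕ) {R : Type*} [CommRing R] [Algebra ℚ R]
    (P Q : MvPolynomial (Fin 2) R) : R :=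
  ∑ i ∈ Finset.range (k + 1),
    ((-1 : ℚ) ^ i * ((k.choose i : ℚ))⁻¹) •
      (MvPolynomial.coeff (expo k i) P * MvPolynomial.coeff (expo k (k - i)) Q)

/-- The linear form `l X + m Y`. -/
noncomputable def linForm {R : Type*} [CommRing R] (l m : R) : MvPolynomial (Fin 2) R :=
  X 0 * C l + X 1 * C m

lemma monomial_expo {R : Type*} [CommRing R] (k i : ℕ) (r : R) :
    monomial (expo k i) r = C r * (X 0 ^ i * X 1 ^ (k - i)) := by
  rw [X_pow_eq_monomial, X_pow_eq_monomial, monomial_mul, C_mul_monomial, expo]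
  simp

lemma expo_inj {k i j : ℕ} : expo k i = expo k j ↔ i = j := by
  refine ⟨fun h => ?_, fun h => h ▸ rfl⟩
  simpa [expo] using DFunLike.congr_fun h 0

lemma linForm_pow {R : Type*} [CommRing R] (k : ℕ) (l m : R) :
    linForm l m ^ k = ∑ i ∈ Finset.range (k + 1),
      monomial (expo k i) (l ^ i * m ^ (k - i) * (k.choose i : R)) := by
  rw [linForm, add_pow]
  refine Finset.sum_congr rfl fun i _ => ?_
  rw [monomial_expo]
  simp only [map_mul, map_pow, map_natCast]
  ring

lemma coeff_linForm_pow {R : Type*} [CommRing R] {k i : ℕ} (hi : i ≤ k) (l m : R) :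
    coeff (expo k i) (linForm l m ^ k) = l ^ i * m ^ (k - i) * (k.choose i : R) := by
  simp [linForm_pow, coeff_sum, coeff_monomial, expo_inj, hi]

lemma rho_linForm_pow {R : Type*} [CommRing R] (g : Matrix (Fin 2) (Fin 2) R) (k : ℕ) (l m : R) :
    rho g (linForm l m ^ k) = linForm (g 0 0 * l + g 0 1 * m) (g 1 0 * l + g 1 1 * m) ^ k := by
  simp only [rho, linForm, map_pow, map_add, map_mul, aeval_X, aeval_C, Fin.sum_univ_two,
    algebraMap_eq]
  ring

lemma pairB_linForm_pow (k : ℕ) {R : Type*} [CommRing R] [Algebra ℚ R] (l m l' m' : R) :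
    pairB k (linForm l m ^ k) (linForm l' m' ^ k) = (m * l' - l * m') ^ k := by
  rw [show m * l' - l * m' = -(l * m') + m * l' by ring, add_pow, pairB]
  refine Finset.sum_congr rfl fun i hi => ?_
  have hik : i ≤ k := Nat.lt_succ_iff.mp (Finset.mem_range.mp hi)
  have hc : (k.choose i : ℚ) ≠ 0 := by exact_mod_cast (Nat.choose_pos hik).ne'
  have hu : algebraMap ℚ R (k.choose i : ℚ)⁻¹ * (k.choose i : R) = 1 := by
    rw [← map_natCast (algebraMap ℚ R), ← map_mul, inv_mul_cancel₀ hc, map_one]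
  rw [coeff_linForm_pow hik, coeff_linForm_pow (Nat.sub_le k i), Nat.sub_sub_self hik,
    Nat.choose_symm hik, Algebra.smul_def, map_mul, map_pow, map_neg, map_one, neg_pow (l * m'),
    mul_pow, mul_pow]
  linear_combination ((-1) ^ i * (l ^ i * m ^ (k - i)) * (l' ^ (k - i) * m' ^ i)
    * (k.choose i : R)) * hu

/-- The pairing `pairB` as a bilinear map. -/
noncomputable def pairBilin (k : ℕ) (R : Type*) [CommRing R] [Algebra ℚ R] :
    MvPolynomial (Fin 2) R →ₗ[R] MvPolynomial (Fin 2) R →ₗ[R] R :=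
  LinearMap.mk₂ R (pairB k)
    (fun P P' Q => by simp [pairB, add_mul, Finset.sum_add_distrib])
    (fun r P Q => by
      simp only [pairB, coeff_smul, smul_eq_mul, Finset.mul_sum, mul_assoc, mul_smul_comm])
    (fun P Q Q' => by simp [pairB, mul_add, Finset.sum_add_distrib])
    (fun r P Q => by
      simp only [pairB, coeff_smul, smul_eq_mul, Finset.mul_sum, mul_left_comm, mul_smul_comm])

/-- The substitution `rho g` as a linear map. -/
noncomputable def rhoLin {R : Type*} [CommRing R] (g : Matrix (Fin 2) (Fin 2) R) :
    MvPolynomial (Fin 2) R →ₗ[R] MvPolynomial (Fin 2) R :=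
  (aeval fun i => ∑ j, X j * C (g j i)).toLinearMap

/-- A polynomial with coefficients in a rational vector space that vanishes at every natural
number has zero coefficients. -/
lemma eq_zero_of_forall_sum_pow_smul_eq_zero {M : Type*} [AddCommGroup M] [Module ℚ M]
    {n : ℕ} {v : ℕ → M} (h : ∀ t : ℕ, ∑ i ∈ Finset.range n, (t : ℚ) ^ i • v i = 0)
    {i : ℕ} (hi : i < n) : v i = 0 := by
  rw [← Module.forall_dual_apply_eq_zero_iff ℚ]
  intro φ
  let p : Polynomial ℚ := ∑ j ∈ Finset.range n, Polynomial.monomial j (φ (v j))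
  have hp : p = 0 := by
    refine p.eq_zero_of_infinite_isRoot
      ((Set.infinite_range_of_injective Nat.cast_injective).mono ?_)
    rintro _ ⟨t, rfl⟩
    have ht := congrArg φ (h t)
    simp only [map_sum, map_smul, smul_eq_mul, map_zero] at ht
    simpa [p, Polynomial.IsRoot, Polynomial.eval_finsetSum, mul_comm] using ht
  have hc := congrArg (Polynomial.coeff · i) hp
  simpa [p, Polynomial.finsetSum_coeff, Polynomial.coeff_monomial, hi] using hc

lemma eq_sum_monomial_expo {R : Type*} [CommRing R] {k : ℕ} {P : MvPolynomial (Fin 2) R}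
    (hP : P ∈ Lk R k) :
    P = ∑ i ∈ Finset.range (k + 1), monomial (expo k i) (coeff (expo k i) P) := by
  ext d
  simp only [coeff_sum, coeff_monomial]
  by_cases hd : d 0 + d 1 = k
  · have hexpo (i : ℕ) : expo k i = d ↔ i = d 0 := by
      rw [show d = expo k (d 0) by ext j; (fin_cases j <;> simp [expo]); omega, expo_inj]
      simp [expo]
    simp only [hexpo, Finset.sum_ite_eq', Finset.mem_range]
    rw [if_pos (by omega), (hexpo (d 0)).mpr rfl]
  · rw [((mem_homogeneousSubmodule k P).mp hP).coeff_eq_zero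
      (by simpa [Finsupp.degree_eq_sum] using hd)]
    refine (Finset.sum_eq_zero fun i hi => if_neg fun h => hd ?_).symm
    have := Finset.mem_range.mp hi
    simp only [← h, expo, Finsupp.add_apply, Finsupp.single_apply]
    simp
    omega

/-- The `k`-th powers of the forms `t X + Y` with `t : ℕ` span the homogeneous polynomials of
degree `k`. -/
lemma linearMap_eq_zero_of_linForm_pow {R M : Type*} [CommRing R]
    [AddCommGroup M] [Module R M] [Module ℚ M] {k : ℕ}
    {f : MvPolynomial (Fin 2) R →ₗ[R] M}
    (hf : ∀ t : ℕ, f (linForm (t : R) 1 ^ k) = 0)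
    {P : MvPolynomial (Fin 2) R} (hP : P ∈ Lk R k) : f P = 0 := by
  have hmon {i : ℕ} (hi : i < k + 1) : f (monomial (expo k i) 1) = 0 := by
    have h := eq_zero_of_forall_sum_pow_smul_eq_zero
      (v := fun i => (k.choose i : ℚ) • f (monomial (expo k i) 1)) (fun t => ?_) hi
    · exact (smul_eq_zero.mp h).resolve_left
        (by exact_mod_cast (Nat.choose_pos (Nat.lt_succ_iff.mp hi)).ne')
    · rw [← hf t, linForm_pow, map_sum]
      refine Finset.sum_congr rfl fun j _ => ?_
      rw [one_pow, mul_one, ← mul_one (_ * _ : R), ← smul_eq_mul, ← smul_monomial, map_smul,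
        smul_smul]
      norm_cast
  rw [eq_sum_monomial_expo hP, map_sum]
  refine Finset.sum_eq_zero fun i hi => ?_
  rw [← mul_one (coeff _ P), ← smul_eq_mul, ← smul_monomial, map_smul,
    hmon (Finset.mem_range.mp hi), smul_zero]

lemma bilin_eq_of_linForm_pow {R : Type*} [CommRing R] [Algebra ℚ R] {k : ℕ}
    {B B' : MvPolynomial (Fin 2) R →ₗ[R] MvPolynomial (Fin 2) R →ₗ[R] R}
    (h : ∀ l l' : R, B (linForm l 1 ^ k) (linForm l' 1 ^ k)
      = B' (linForm l 1 ^ k) (linForm l' 1 ^ k))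
    {P Q : MvPolynomial (Fin 2) R} (hP : P ∈ Lk R k) (hQ : Q ∈ Lk R k) : B P Q = B' P Q := by
  refine sub_eq_zero.mp (linearMap_eq_zero_of_linForm_pow (f := B P - B' P) (fun t => ?_) hQ)
  exact linearMap_eq_zero_of_linForm_pow
    (f := (B - B').flip (linForm (t : R) 1 ^ k)) (fun s => sub_eq_zero.mpr (h s t)) hP

/-- Over a commutative `ℚ`-algebra `R`, for every `2 × 2`
matrix `g` and all `P, Q ∈ L_k`:
`⟨ρ(g)P, Q⟩_k = ⟨P, ρ(g′)Q⟩_k` where `g′ = [[d,−b],[−c,a]]` is the adjugate of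
`g = [[a,b],[c,d]]`; moreover `⟨P, Q⟩_k = (−1)^k·⟨Q, P⟩_k`. -/
theorem stmt16 (k : ℕ) {R : Type*} [CommRing R] [Algebra ℚ R] :
    (∀ g : Matrix (Fin 2) (Fin 2) R,
      ∀ P ∈ Lk R k, ∀ Q ∈ Lk R k,
        pairB k (rho g P) Q
          = pairB k P (rho !![g 1 1, -(g 0 1); -(g 1 0), g 0 0] Q)) ∧
    (∀ P ∈ Lk R k, ∀ Q ∈ Lk R k,
      pairB k P Q = (-1 : R) ^ k * pairB k Q P) := by
  refine ⟨fun g P hP Q hQ => ?_, fun P hP Q hQ => ?_⟩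
  · refine bilin_eq_of_linForm_pow (B := (pairBilin k R).comp (rhoLin g))
      (B' := (pairBilin k R).compl₂ (rhoLin !![g 1 1, -(g 0 1); -(g 1 0), g 0 0]))
      (fun l l' => ?_) hP hQ
    change pairB k (rho _ _) _ = pairB k _ (rho _ _)
    rw [rho_linForm_pow, rho_linForm_pow, pairB_linForm_pow, pairB_linForm_pow]
    simp only [Matrix.of_apply, Matrix.cons_val]
    ring
  · refine bilin_eq_of_linForm_pow (B := pairBilin k R)
      (B' := (-1 : R) ^ k • (pairBilin k R).flip) (fun l l' => ?_) hP hQ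
    change pairB k _ _ = (-1 : R) ^ k * pairB k _ _
    rw [pairB_linForm_pow, pairB_linForm_pow, ← mul_pow]
    ring
end
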